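/- arXiv:1712.07202 — 2 statements merged into one kernel-verified Lean document; each statement's English description precedes it below -/
import Mathlib

section
/- Let π be a maximizer of the Nash functional F over Borel probability measures on X × Y with second marginal ν, and define the cost c(x, y) = −ln s(x, y). Then the support of π is c-cyclically monotone: for every finite sequence (x₁, y₁), …, (x_k, y_k) of points in the support of π, Σ_{i=1}^k c(x_i, y_i) ≤ Σ_{i=1}^k c(x_i, y_{i−1}), where indices are taken cyclically with y₀ = y_k. Consequently π is an optimal transport plan, for the cost c, between its first marginal α and ν. -/
open MeasureTheory

/-- The measure `ν_i(B) = π({p_i} × B)` describing player `i`'s allocation. -/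
noncomputable def nuI {Y : Type*} [MeasurableSpace Y] {N : ℕ}
    (π : Measure (Fin N × Y)) (i : Fin N) : Measure Y :=
  (π.restrict ({i} ×ˢ (Set.univ : Set Y))).map Prod.snd

/-- The Nash functional `F(π) = ln N + (1/N) ∑ᵢ ln ∫ s(pᵢ,y) dνᵢ(y)`, equal to `⊥ = -∞`
if some of the integrals vanishes. -/
noncomputable def NashF {Y : Type*} [MeasurableSpace Y] {N : ℕ}
    (s : Fin N → Y → ℝ) (π : Measure (Fin N × Y)) : EReal :=
  if ∀ i : Fin N, 0 < ∫ y, s i y ∂(nuI π i) then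
    ((Real.log N + (1 / (N : ℝ)) * ∑ i : Fin N, Real.log (∫ y, s i y ∂(nuI π i)) : ℝ) : EReal)
  else ⊥

/-- The optimal transport cost `W_c(μ, β)`: infimum of `∫ c dπ` over all probability
measures `π` with first marginal `μ` and second marginal `β`. -/
noncomputable def Wcost {X Y : Type*} [MeasurableSpace X] [MeasurableSpace Y]
    (c : X → Y → ℝ) (μ : Measure X) (β : Measure Y) : ℝ :=
  sInf {r : ℝ | ∃ π : Measure (X × Y), IsProbabilityMeasure π ∧
    π.map Prod.fst = μ ∧ π.map Prod.snd = β ∧ r = ∫ p, c p.1 p.2 ∂π}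

lemma continuous_uncurry_of_fin {Y : Type*} [TopologicalSpace Y] {N : ℕ} {f : Fin N → Y → ℝ}
    (hf : ∀ i, Continuous (f i)) : Continuous (fun p : Fin N × Y => f p.1 p.2) :=
  continuous_prod_of_discrete_left.2 hf

lemma integrable_of_continuous_of_compactSpace {Z : Type*} [TopologicalSpace Z] [CompactSpace Z]
    [MeasurableSpace Z] [OpensMeasurableSpace Z] {f : Z → ℝ} (hf : Continuous f)
    (μ : Measure Z) [IsFiniteMeasure μ] : Integrable f μ :=
  hf.integrable_of_hasCompactSupport (HasCompactSupport.of_compactSpace f)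

lemma measurableSet_singleton_prod_univ {Y : Type*} [MeasurableSpace Y] {N : ℕ} (k : Fin N) :
    MeasurableSet (({k} : Set (Fin N)) ×ˢ (Set.univ : Set Y)) :=
  (measurableSet_singleton k).prod MeasurableSet.univ

lemma isProbabilityMeasure_convexCombination {Z : Type*} [MeasurableSpace Z] (π ρ : Measure Z)
    [IsProbabilityMeasure π] [IsProbabilityMeasure ρ] {t : ℝ} (ht0 : 0 ≤ t) (ht1 : t ≤ 1) :
    IsProbabilityMeasure (ENNReal.ofReal (1 - t) • π + ENNReal.ofReal t • ρ) := by
  constructor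
  simp [← ENNReal.ofReal_add (sub_nonneg.2 ht1) ht0]

lemma map_convexCombination_eq {Z W : Type*} [MeasurableSpace Z] [MeasurableSpace W]
    {π ρ : Measure Z} {ν : Measure W} {g : Z → W} (hg : Measurable g)
    (hπ : π.map g = ν) (hρ : ρ.map g = ν) {t : ℝ} (ht0 : 0 ≤ t) (ht1 : t ≤ 1) :
    (ENNReal.ofReal (1 - t) • π + ENNReal.ofReal t • ρ).map g = ν := by
  rw [Measure.map_add _ _ hg, Measure.map_smul, Measure.map_smul, hπ, hρ, ← add_smul,
    ← ENNReal.ofReal_add (sub_nonneg.2 ht1) ht0]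
  simp

/-- First-order consequence of `∑ log (1 + t * d k)` being maximal at `t = 0`. -/
lemma sum_nonpos_of_sum_log_nonpos {ι : Type*} [Fintype ι] (d : ι → ℝ)
    (h : ∀ t : ℝ, 0 < t → t < 1 → ∑ k, Real.log (1 + t * d k) ≤ 0) : ∑ k, d k ≤ 0 := by
  have hd : HasDerivAt (fun t : ℝ => ∑ k, Real.log (1 + t * d k)) (∑ k, d k) 0 := by
    refine HasDerivAt.fun_sum fun k _ => ?_
    have h1 : HasDerivAt (fun t : ℝ => 1 + t * d k) (d k) 0 := by
      simpa using ((hasDerivAt_id (0 : ℝ)).mul_const (d k)).const_add 1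
    simpa using h1.log (by simp)
  refine le_of_tendsto (hd.tendsto_slope_zero_right) ?_
  filter_upwards [Ioo_mem_nhdsGT (zero_lt_one' ℝ)] with t ht
  simpa using mul_nonpos_of_nonneg_of_nonpos (inv_nonneg.2 ht.1.le) (h t ht.1 ht.2)

lemma integral_nuI_nonneg {Y : Type*} [MeasurableSpace Y] {N : ℕ} {s : Fin N → Y → ℝ}
    (hpos : ∀ i y, 0 < s i y)
    (π : Measure (Fin N × Y)) (k : Fin N) : 0 ≤ ∫ y, s k y ∂(nuI π k) :=
  integral_nonneg fun y => (hpos k y).le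

lemma integral_nuI {Y : Type*} [MetricSpace Y] [MeasurableSpace Y] [BorelSpace Y] {N : ℕ}
    {f : Fin N → Y → ℝ} (hf : ∀ i, Continuous (f i))
    (π : Measure (Fin N × Y)) (k : Fin N) :
    ∫ y, f k y ∂(nuI π k) = ∫ p in {k} ×ˢ Set.univ, f p.1 p.2 ∂π := by
  rw [nuI, integral_map measurable_snd.aemeasurable (hf k).aestronglyMeasurable]
  refine setIntegral_congr_fun (measurableSet_singleton_prod_univ k) ?_
  rintro ⟨i, y⟩ ⟨hi, -⟩
  obtain rfl : i = k := hi
  rfl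

section NashMaximizer

variable {Y : Type*} [MetricSpace Y] [CompactSpace Y] [MeasurableSpace Y] [BorelSpace Y] {N : ℕ}

lemma integrable_uncurry_of_fin {f : Fin N → Y → ℝ} (hf : ∀ i, Continuous (f i))
    (π : Measure (Fin N × Y)) [IsFiniteMeasure π] :
    Integrable (fun p : Fin N × Y => f p.1 p.2) π :=
  integrable_of_continuous_of_compactSpace (continuous_uncurry_of_fin hf) π

lemma integral_eq_sum_integral_nuI {f : Fin N → Y → ℝ} (hf : ∀ i, Continuous (f i))
    (π : Measure (Fin N × Y)) [IsFiniteMeasure π] :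
    ∫ p, f p.1 p.2 ∂π = ∑ k, ∫ y, f k y ∂(nuI π k) := by
  simp_rw [integral_nuI hf π]
  rw [← integral_iUnion_fintype (fun k => measurableSet_singleton_prod_univ k) _
    (fun k => (integrable_uncurry_of_fin hf π).integrableOn)]
  · have : (⋃ k : Fin N, ({k} : Set (Fin N)) ×ˢ (Set.univ : Set Y)) = Set.univ := by
      ext p
      simp
    rw [this, setIntegral_univ]
  · intro i j hij
    refine Set.disjoint_left.2 ?_
    rintro p ⟨hi, -⟩ ⟨hj, -⟩
    exact hij ((Set.mem_singleton_iff.1 hi).symm.trans (Set.mem_singleton_iff.1 hj))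

lemma integral_nuI_convexCombination {f : Fin N → Y → ℝ} (hf : ∀ i, Continuous (f i))
    (π ρ : Measure (Fin N × Y)) [IsFiniteMeasure π] [IsFiniteMeasure ρ] {t : ℝ}
    (ht0 : 0 ≤ t) (ht1 : t ≤ 1) (k : Fin N) :
    ∫ y, f k y ∂(nuI (ENNReal.ofReal (1 - t) • π + ENNReal.ofReal t • ρ) k) =
      (1 - t) * ∫ y, f k y ∂(nuI π k) + t * ∫ y, f k y ∂(nuI ρ k) := by
  simp_rw [integral_nuI hf]
  rw [Measure.restrict_add, Measure.restrict_smul, Measure.restrict_smul,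
    integral_add_measure, integral_smul_measure, integral_smul_measure,
    ENNReal.toReal_ofReal ht0, ENNReal.toReal_ofReal (sub_nonneg.2 ht1), smul_eq_mul, smul_eq_mul]
  · exact ((integrable_uncurry_of_fin hf π).integrableOn).smul_measure ENNReal.ofReal_ne_top
  · exact ((integrable_uncurry_of_fin hf ρ).integrableOn).smul_measure ENNReal.ofReal_ne_top

variable {ν : Measure Y} [IsProbabilityMeasure ν] {s : Fin N → Y → ℝ} {π : Measure (Fin N × Y)}

lemma integral_nuI_pos_of_maximizer (hN : 0 < N) (hs : ∀ i, Continuous (s i))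
    (hpos : ∀ i y, 0 < s i y)
    (hmax : ∀ π' : Measure (Fin N × Y), IsProbabilityMeasure π' → π'.map Prod.snd = ν →
      NashF s π' ≤ NashF s π) (k : Fin N) : 0 < ∫ y, s k y ∂(nuI π k) := by
  have : Nonempty (Fin N) := ⟨⟨0, hN⟩⟩
  let u : Measure (Fin N) := (PMF.uniformOfFintype (Fin N)).toMeasure
  have hu : ∀ i, u {i} ≠ 0 := fun i => by
    simp [u]
  have hprod : ∀ i, 0 < ∫ y, s i y ∂(nuI (u.prod ν) i) := fun i => by
    rw [integral_nuI hs, setIntegral_pos_iff_support_of_nonneg_ae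
      (f := fun p : Fin N × Y => s p.1 p.2)
      (Filter.Eventually.of_forall fun p => (hpos p.1 p.2).le)
      (integrable_uncurry_of_fin hs (u.prod ν)).integrableOn]
    have hsupp : Function.support (fun p : Fin N × Y => s p.1 p.2) = Set.univ :=
      Set.eq_univ_of_forall fun p => (hpos p.1 p.2).ne'
    rw [hsupp, Set.univ_inter, Measure.prod_prod]
    simpa using pos_iff_ne_zero.2 (hu i)
  have hle := hmax (u.prod ν) inferInstance (by simp [u])
  by_contra hk
  have hbot : NashF s π = ⊥ := if_neg fun h => hk (h k)
  rw [hbot, NashF, if_pos hprod] at hle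
  exact EReal.coe_ne_bot _ (le_bot_iff.1 hle)

/-- First-order optimality of a Nash maximizer `π` against a competitor `ρ`. -/
lemma sum_integral_nuI_div_le_of_maximizer (hN : 0 < N) (hs : ∀ i, Continuous (s i))
    (hpos : ∀ i y, 0 < s i y) [IsProbabilityMeasure π] (hmarg : π.map Prod.snd = ν)
    (hmax : ∀ π' : Measure (Fin N × Y), IsProbabilityMeasure π' → π'.map Prod.snd = ν →
      NashF s π' ≤ NashF s π)
    (ρ : Measure (Fin N × Y)) [IsProbabilityMeasure ρ] (hρ : ρ.map Prod.snd = ν) :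
    ∑ k, (∫ y, s k y ∂(nuI ρ k)) / (∫ y, s k y ∂(nuI π k)) ≤ N := by
  have hI := integral_nuI_pos_of_maximizer hN hs hpos hmax
  suffices h : ∑ k, ((∫ y, s k y ∂(nuI ρ k)) / (∫ y, s k y ∂(nuI π k)) - 1) ≤ 0 by
    simpa [Finset.sum_sub_distrib] using h
  refine sum_nonpos_of_sum_log_nonpos _ fun t ht0 ht1 => ?_
  have hmix := integral_nuI_convexCombination hs π ρ ht0.le ht1.le
  have hmixpos : ∀ k, 0 < ∫ y, s k y
      ∂(nuI (ENNReal.ofReal (1 - t) • π + ENNReal.ofReal t • ρ) k) := fun k => by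
    rw [hmix]
    exact add_pos_of_pos_of_nonneg (mul_pos (sub_pos.2 ht1) (hI k))
      (mul_nonneg ht0.le (integral_nuI_nonneg hpos ρ k))
  have hle := hmax _ (isProbabilityMeasure_convexCombination π ρ ht0.le ht1.le)
    (map_convexCombination_eq measurable_snd hmarg hρ ht0.le ht1.le)
  rw [NashF, NashF, if_pos hmixpos, if_pos hI, EReal.coe_le_coe_iff, add_le_add_iff_left,
    mul_le_mul_iff_right₀ (by positivity), ← sub_nonpos, ← Finset.sum_sub_distrib] at hle
  refine le_of_eq_of_le (Finset.sum_congr rfl fun k _ => ?_) hle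
  rw [← Real.log_div (hmixpos k).ne' (hI k).ne', hmix]
  congr 1
  field_simp [(hI k).ne']
  ring

/-- Almost every good goes to a player maximizing the utility normalized by total utility. -/
lemma ae_div_le_of_maximizer (hN : 0 < N) (hs : ∀ i, Continuous (s i))
    (hpos : ∀ i y, 0 < s i y) [IsProbabilityMeasure π] (hmarg : π.map Prod.snd = ν)
    (hmax : ∀ π' : Measure (Fin N × Y), IsProbabilityMeasure π' → π'.map Prod.snd = ν →
      NashF s π' ≤ NashF s π) (j : Fin N) :
    ∀ᵐ p ∂π, s j p.2 / (∫ y, s j y ∂(nuI π j)) ≤ s p.1 p.2 / (∫ y, s p.1 y ∂(nuI π p.1)) := by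
  classical
  have hI := integral_nuI_pos_of_maximizer hN hs hpos hmax
  set g : Fin N → Y → ℝ := fun k y => s k y / (∫ y, s k y ∂(nuI π k)) with hg
  have hgc : ∀ k, Continuous (g k) := fun k => (hs k).div_const _
  have hA : MeasurableSet {p : Fin N × Y | g p.1 p.2 < g j p.2} :=
    (isOpen_lt (continuous_uncurry_of_fin hgc) ((hgc j).comp continuous_snd)).measurableSet
  let T : Fin N × Y → Fin N × Y := fun p => if g p.1 p.2 < g j p.2 then (j, p.2) else p
  have hT : Measurable T := Measurable.ite hA (measurable_const.prodMk measurable_snd) measurable_id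
  have hTsnd : Prod.snd ∘ T = Prod.snd := by
    funext p
    by_cases h : g p.1 p.2 < g j p.2 <;> simp [T, h]
  have hTg : ∀ p, g (T p).1 (T p).2 = max (g p.1 p.2) (g j p.2) := fun p => by
    by_cases h : g p.1 p.2 < g j p.2
    · simp [T, h, h.le]
    · simp [T, h, not_lt.1 h]
  have : IsProbabilityMeasure (π.map T) := Measure.isProbabilityMeasure_map hT.aemeasurable
  have hle := sum_integral_nuI_div_le_of_maximizer hN hs hpos hmarg hmax (π.map T)
    (by rw [Measure.map_map measurable_snd hT, hTsnd, hmarg])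
  simp_rw [← integral_div] at hle
  have hself : ∫ p, g p.1 p.2 ∂π = N := by
    rw [integral_eq_sum_integral_nuI hgc]
    simp_rw [hg, integral_div, div_self (hI _).ne']
    simp
  have hcomp : ∫ p, max (g p.1 p.2) (g j p.2) ∂π ≤ ∫ p, g p.1 p.2 ∂π := by
    rw [hself]
    refine le_of_eq_of_le ?_ hle
    rw [← integral_eq_sum_integral_nuI hgc, integral_map hT.aemeasurable
      (continuous_uncurry_of_fin hgc).aestronglyMeasurable]
    simp_rw [hTg]
  have hint := integrable_uncurry_of_fin hgc π
  have hintmax : Integrable (fun p : Fin N × Y => max (g p.1 p.2) (g j p.2)) π :=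
    integrable_of_continuous_of_compactSpace
      ((continuous_uncurry_of_fin hgc).max ((hgc j).comp continuous_snd)) π
  have hae := (integral_eq_iff_of_ae_le hint hintmax
    (Filter.Eventually.of_forall fun p => le_max_left _ _)).1
    (le_antisymm (integral_mono hint hintmax fun p => le_max_left _ _) hcomp)
  filter_upwards [hae] with p hp
  exact max_eq_left_iff.1 hp.symm

end NashMaximizer

/-- A transport plan concentrated on the contact set of a dual potential is optimal. -/
lemma integral_eq_Wcost_of_ae_add_le {Y : Type*} [MetricSpace Y] [CompactSpace Y]
    [MeasurableSpace Y] [BorelSpace Y] {N : ℕ} (hN : 0 < N) {ν : Measure Y}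
    {c : Fin N → Y → ℝ} (hc : ∀ i, Continuous (c i)) (L : Fin N → ℝ)
    {π : Measure (Fin N × Y)} [IsProbabilityMeasure π] (hmarg : π.map Prod.snd = ν)
    (h : ∀ j, ∀ᵐ p ∂π, c p.1 p.2 + L p.1 ≤ c j p.2 + L j) :
    ∫ p, c p.1 p.2 ∂π = Wcost c (π.map Prod.fst) ν := by
  have : Nonempty (Fin N) := ⟨⟨0, hN⟩⟩
  let m : Y → ℝ := fun y => Finset.univ.inf' Finset.univ_nonempty fun j => c j y + L j
  have hm : Continuous m :=
    Continuous.finset_inf'_apply _ fun j _ => (hc j).add continuous_const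
  have hmle : ∀ p : Fin N × Y, m p.2 ≤ c p.1 p.2 + L p.1 := fun p =>
    Finset.inf'_le (fun j => c j p.2 + L j) (Finset.mem_univ p.1)
  have hmeq : ∀ᵐ p ∂π, c p.1 p.2 + L p.1 = m p.2 := by
    filter_upwards [ae_all_iff.2 h] with p hp
    exact le_antisymm (Finset.le_inf' _ _ fun j _ => hp j) (hmle p)
  have hsplit : ∀ (ρ : Measure (Fin N × Y)) [IsProbabilityMeasure ρ],
      ρ.map Prod.fst = π.map Prod.fst →
      ∫ p, (c p.1 p.2 + L p.1) ∂ρ = ∫ p, c p.1 p.2 ∂ρ + ∫ i, L i ∂(π.map Prod.fst) := by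
    intro ρ _ hρ
    rw [integral_add (integrable_uncurry_of_fin hc ρ)
      (integrable_uncurry_of_fin (f := fun i _ => L i) (fun _ => continuous_const) ρ), ← hρ,
      integral_map measurable_fst.aemeasurable
      (measurable_of_countable L).aestronglyMeasurable]
  have hsnd : ∀ ρ : Measure (Fin N × Y), ρ.map Prod.snd = ν →
      ∫ p, m p.2 ∂ρ = ∫ y, m y ∂ν := by
    intro ρ hρ
    rw [← hρ, integral_map measurable_snd.aemeasurable hm.aestronglyMeasurable]
  refine ((IsLeast.csInf_eq (a := ∫ p, c p.1 p.2 ∂π) ?_).symm : _ = sInf _)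
  refine ⟨⟨π, inferInstance, rfl, hmarg, rfl⟩, ?_⟩
  rintro r ⟨ρ, hρ, hfst, hρsnd, rfl⟩
  have hle : ∫ p, m p.2 ∂ρ ≤ ∫ p, (c p.1 p.2 + L p.1) ∂ρ :=
    integral_mono (integrable_of_continuous_of_compactSpace (hm.comp continuous_snd) ρ)
      (integrable_uncurry_of_fin (f := fun i y => c i y + L i)
        (fun i => (hc i).add continuous_const) ρ) hmle
  have heq := integral_congr_ae hmeq
  rw [hsplit π rfl, hsnd π hmarg] at heq
  rw [hsplit ρ hfst, hsnd ρ hρsnd] at hle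
  linarith

/-- the support of a maximizer `π` of the Nash functional is
`c`-cyclically monotone for `c(x,y) = -ln s(x,y)` (stated cyclically: for points
`(x_l, y_l)` of the support, `∑ c(x_l, y_l) ≤ ∑ c(x_{l+1}, y_l)`), and consequently `π`
is an optimal transport plan for the cost `c` between its first marginal and `ν`. -/
theorem nash_maximizer_cyclically_monotone_and_optimal
    {Y : Type*} [MetricSpace Y] [CompactSpace Y] [MeasurableSpace Y] [BorelSpace Y]
    (ν : Measure Y) [IsProbabilityMeasure ν] {N : ℕ} (hN : 0 < N)
    (s : Fin N → Y → ℝ) (hs : ∀ i, Continuous (s i)) (hpos : ∀ i y, 0 < s i y)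
    (c : Fin N → Y → ℝ) (hc : ∀ i y, c i y = - Real.log (s i y))
    (π : Measure (Fin N × Y)) (hπ : IsProbabilityMeasure π) (hmarg : π.map Prod.snd = ν)
    (hmax : ∀ π' : Measure (Fin N × Y), IsProbabilityMeasure π' → π'.map Prod.snd = ν →
      NashF s π' ≤ NashF s π) :
    (∀ k : ℕ, ∀ x : Fin (k + 1) → Fin N, ∀ y : Fin (k + 1) → Y,
      (∀ l : Fin (k + 1), ∀ U : Set Y, IsOpen U → y l ∈ U → 0 < π ({x l} ×ˢ U)) →
      ∑ l : Fin (k + 1), c (x l) (y l) ≤ ∑ l : Fin (k + 1), c (x (l + 1)) (y l)) ∧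
    ∫ p, c p.1 p.2 ∂π = Wcost c (π.map Prod.fst) ν := by
  have hI := integral_nuI_pos_of_maximizer hN hs hpos hmax
  set L : Fin N → ℝ := fun k => Real.log (∫ y, s k y ∂(nuI π k)) with hL
  have hcc : ∀ i, Continuous (c i) := fun i => by
    rw [funext (hc i)]
    exact ((hs i).log fun y => (hpos i y).ne').neg
  have hae : ∀ j, ∀ᵐ p ∂π, c p.1 p.2 + L p.1 ≤ c j p.2 + L j := fun j => by
    filter_upwards [ae_div_le_of_maximizer hN hs hpos hmarg hmax j] with p hp
    have hlog := Real.log_le_log (div_pos (hpos j p.2) (hI j)) hp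
    rw [Real.log_div (hpos _ _).ne' (hI _).ne', Real.log_div (hpos _ _).ne' (hI _).ne'] at hlog
    rw [hc, hc]
    linarith
  refine ⟨fun k x y hxy => ?_, integral_eq_Wcost_of_ae_add_le hN hcc L hmarg hae⟩
  have hpt : ∀ l, c (x l) (y l) + L (x l) ≤ c (x (l + 1)) (y l) + L (x (l + 1)) := by
    intro l
    by_contra! hlt
    refine (hxy l {z | c (x (l + 1)) z + L (x (l + 1)) < c (x l) z + L (x l)}
      (isOpen_lt ((hcc _).add continuous_const) ((hcc _).add continuous_const)) hlt).ne' ?_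
    refine measure_mono_null ?_ (ae_iff.1 (hae (x (l + 1))))
    rintro ⟨i, z⟩ ⟨hi, hz⟩
    obtain rfl : i = x l := hi
    exact not_le.2 hz
  have hsum := Finset.sum_le_sum fun l (_ : l ∈ Finset.univ) => hpt l
  rw [Finset.sum_add_distrib, Finset.sum_add_distrib] at hsum
  have hshift : ∑ l, L (x (l + 1)) = ∑ l, L (x l) :=
    Equiv.sum_comp (Equiv.addRight (1 : Fin (k + 1))) fun l => L (x l)
  linarith
end

section
/- Let π be a maximizer of the Nash functional F over Borel probability measures on X × Y with second marginal ν, let α be the first marginal of π, and set a₀ = (min_{X×Y} s / max_{X×Y} s)². Then for every i, a₀/(a₀ + N − 1) ≤ α({p_i}) ≤ 1/(1 + (N − 1)a₀); in particular the ratio of any two masses satisfies α({p_i})/α({p_j}) ≥ a₀. -/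
open MeasureTheory

open scoped NNReal

lemma nuI_apply {Y : Type*} [MeasurableSpace Y] {N : ℕ} (π : Measure (Fin N × Y)) (i : Fin N)
    {B : Set Y} (hB : MeasurableSet B) : nuI π i B = π ({i} ×ˢ B) := by
  rw [nuI, Measure.map_apply measurable_snd hB, Measure.restrict_apply (measurable_snd hB)]
  congr 1
  ext ⟨k, y⟩
  simp [and_comm]

instance {Y : Type*} [MeasurableSpace Y] {N : ℕ} (π : Measure (Fin N × Y)) [IsFiniteMeasure π]
    (i : Fin N) : IsFiniteMeasure (nuI π i) := by
  unfold nuI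
  infer_instance

lemma sum_nuI {Y : Type*} [MeasurableSpace Y] {N : ℕ} (π : Measure (Fin N × Y)) :
    ∑ i, nuI π i = π.map Prod.snd := by
  ext B hB
  rw [Measure.finsetSum_apply, Measure.map_apply measurable_snd hB]
  simp_rw [nuI_apply π _ hB]
  rw [← tsum_fintype (L := .unconditional _), ← measure_iUnion]
  · congr 1
    ext ⟨k, y⟩
    simp
  · intro i j hij
    rw [Function.onFun, Set.disjoint_left]
    rintro ⟨k, y⟩ h h'
    simp only [Set.mem_prod, Set.mem_singleton_iff] at h h'
    exact hij (h.1.symm.trans h'.1)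
  · exact fun i => (measurableSet_singleton i).prod hB

/-- The measure on `Fin N × Y` which allocates `μ i` to player `i`. -/
noncomputable def ofAllocation {Y : Type*} [MeasurableSpace Y] {N : ℕ} (μ : Fin N → Measure Y) :
    Measure (Fin N × Y) :=
  ∑ k, (μ k).map (Prod.mk k)

lemma nuI_ofAllocation {Y : Type*} [MeasurableSpace Y] {N : ℕ} (μ : Fin N → Measure Y)
    (i : Fin N) : nuI (ofAllocation μ) i = μ i := by
  ext B hB
  have hm : MeasurableSet (({i} : Set (Fin N)) ×ˢ B) := (measurableSet_singleton i).prod hB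
  rw [nuI_apply _ _ hB, ofAllocation, Measure.finsetSum_apply, Finset.sum_eq_single i]
  · rw [Measure.map_apply measurable_prodMk_left hm]
    congr 1
    ext y
    simp
  · intro k _ hk
    rw [Measure.map_apply measurable_prodMk_left hm]
    convert measure_empty (μ := μ k)
    ext y
    simp [hk]
  · simp

lemma map_snd_ofAllocation {Y : Type*} [MeasurableSpace Y] {N : ℕ} (μ : Fin N → Measure Y) :
    (ofAllocation μ).map Prod.snd = ∑ k, μ k := by
  simp_rw [← sum_nuI, nuI_ofAllocation]

lemma sum_log_le_of_maximizer {Y : Type*} [MeasurableSpace Y] {ν : Measure Y}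
    [IsProbabilityMeasure ν] {N : ℕ} (hN : 0 < N) {s : Fin N → Y → ℝ} {π : Measure (Fin N × Y)}
    (hmax : ∀ π' : Measure (Fin N × Y), IsProbabilityMeasure π' → π'.map Prod.snd = ν →
      NashF s π' ≤ NashF s π)
    {μ : Fin N → Measure Y} (hμ : ∑ k, μ k = ν) (hμpos : ∀ k, 0 < ∫ y, s k y ∂(μ k)) :
    (∀ k, 0 < ∫ y, s k y ∂(nuI π k)) ∧
      ∑ k, Real.log (∫ y, s k y ∂(μ k)) ≤ ∑ k, Real.log (∫ y, s k y ∂(nuI π k)) := by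
  have hsnd : (ofAllocation μ).map Prod.snd = ν := (map_snd_ofAllocation μ).trans hμ
  have hprob : IsProbabilityMeasure (ofAllocation μ) := by
    refine ⟨?_⟩
    rw [← Set.preimage_univ (f := Prod.snd), ← Measure.map_apply measurable_snd .univ, hsnd,
      measure_univ]
  have h := hmax _ hprob hsnd
  unfold NashF at h
  simp_rw [nuI_ofAllocation] at h
  rw [if_pos hμpos] at h
  split_ifs at h with hp
  · refine ⟨hp, ?_⟩
    rw [EReal.coe_le_coe_iff, add_le_add_iff_left] at h
    exact le_of_mul_le_mul_left h (by positivity)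
  · exact absurd h (not_le.2 (EReal.bot_lt_coe _))

lemma sum_eq_add_add_sum_erase {M : Type*} [AddCommMonoid M] {N : ℕ} (f : Fin N → M)
    {i j : Fin N} (hij : i ≠ j) :
    ∑ k, f k = f i + f j + ∑ k ∈ (Finset.univ.erase i).erase j, f k := by
  rw [add_assoc, Finset.add_sum_erase _ _ (by simp [hij.symm]),
    Finset.add_sum_erase _ _ (Finset.mem_univ i)]

lemma integral_nuI_le_of_maximizer {Y : Type*} [MeasurableSpace Y] {ν : Measure Y}
    [IsProbabilityMeasure ν] {N : ℕ} (hN : 0 < N) {s : Fin N → Y → ℝ} {π : Measure (Fin N × Y)}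
    (hmarg : π.map Prod.snd = ν)
    (hmax : ∀ π' : Measure (Fin N × Y), IsProbabilityMeasure π' → π'.map Prod.snd = ν →
      NashF s π' ≤ NashF s π)
    (hint : ∀ i j, Integrable (s i) (nuI π j)) (hnn : ∀ i y, 0 ≤ s i y)
    (hp : ∀ k, 0 < ∫ y, s k y ∂(nuI π k)) (i j : Fin N) :
    ∫ y, s i y ∂(nuI π j) ≤ ∫ y, s i y ∂(nuI π i) := by
  rcases eq_or_ne i j with rfl | hij
  · exact le_rfl
  set A := ∫ y, s i y ∂(nuI π i) with hA
  set B := ∫ y, s i y ∂(nuI π j) with hB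
  set C := ∫ y, s j y ∂(nuI π j) with hC
  have hB0 : 0 ≤ B := integral_nonneg (hnn i)
  have key : ∀ t u : ℝ≥0, 0 < t → 0 < u → t + u = 1 → u * B ≤ A := by
    intro t u ht hu htu
    let μ : Fin N → Measure Y := fun k =>
      if k = i then nuI π i + t • nuI π j else if k = j then u • nuI π j else nuI π k
    have hμi : μ i = nuI π i + t • nuI π j := by simp [μ]
    have hμj : μ j = u • nuI π j := by simp [μ, hij.symm]
    have hμk : ∀ k ∈ (Finset.univ.erase i).erase j, μ k = nuI π k := by
      intro k hk
      simp only [Finset.mem_erase, Finset.mem_univ, and_true] at hk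
      simp [μ, hk.1, hk.2]
    have hIi : ∫ y, s i y ∂(μ i) = A + t * B := by
      rw [hμi, integral_add_measure (hint i i) ((hint i j).smul_measure_nnreal),
        integral_smul_nnreal_measure]
      rfl
    have hIj : ∫ y, s j y ∂(μ j) = u * C := by
      rw [hμj, integral_smul_nnreal_measure]
      rfl
    have hAB : 0 < A + t * B := by have := hp i; positivity
    have huC : 0 < u * C := by have := hp j; positivity
    have hsum : ∑ k, μ k = ν := by
      rw [← hmarg, ← sum_nuI, sum_eq_add_add_sum_erase _ hij, sum_eq_add_add_sum_erase _ hij,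
        Finset.sum_congr rfl hμk, hμi, hμj, add_assoc (nuI π i), ← add_smul, htu, one_smul]
    have hpos : ∀ k, 0 < ∫ y, s k y ∂(μ k) := by
      intro k
      by_cases hki : k = i
      · rw [hki, hIi]; exact hAB
      by_cases hkj : k = j
      · rw [hkj, hIj]; exact huC
      rw [hμk k (by simp [hki, hkj])]
      exact hp k
    have h := (sum_log_le_of_maximizer hN hmax hsum hpos).2
    rw [sum_eq_add_add_sum_erase _ hij, sum_eq_add_add_sum_erase _ hij,
      Finset.sum_congr rfl (fun k hk => by rw [hμk k hk]), add_le_add_iff_right, hIi, hIj,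
      ← Real.log_mul hAB.ne' huC.ne', ← Real.log_mul (hp i).ne' (hp j).ne',
      Real.log_le_log_iff (mul_pos hAB huC) (mul_pos (hp i) (hp j)), ← hA, ← hC,
      ← mul_assoc, mul_le_mul_iff_left₀ (hp j)] at h
    have htu' : (t : ℝ) + u = 1 := by exact_mod_cast htu
    have ht' : (0 : ℝ) < t := ht
    refine le_of_mul_le_mul_left ?_ ht'
    have : (u : ℝ) = 1 - t := by linarith
    rw [this] at h ⊢
    nlinarith
  refine le_of_forall_pos_lt_add fun ε hε => ?_
  let t : ℝ := min (1 / 2) (ε / (2 * (B + 1)))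
  have ht0 : 0 < t := by positivity
  have ht1 : t ≤ 1 / 2 := min_le_left _ _
  have ht2 : t * (2 * (B + 1)) ≤ ε := (le_div_iff₀ (by positivity)).1 (min_le_right _ _)
  have h := key ⟨t, ht0.le⟩ ⟨1 - t, by linarith⟩ ht0 (show (0 : ℝ) < 1 - t by linarith)
    (NNReal.eq (add_sub_cancel t 1))
  have h : (1 - t) * B ≤ A := h
  nlinarith

lemma mul_real_univ_le_integral {Y : Type*} [MeasurableSpace Y] {μ : Measure Y}
    [IsFiniteMeasure μ] {f : Y → ℝ} (hf : Integrable f μ) {m : ℝ} (h : ∀ y, m ≤ f y) :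
    m * μ.real Set.univ ≤ ∫ y, f y ∂μ := by
  simpa [mul_comm] using integral_mono (integrable_const m) hf h

lemma integral_le_mul_real_univ {Y : Type*} [MeasurableSpace Y] {μ : Measure Y}
    [IsFiniteMeasure μ] {f : Y → ℝ} (hf : Integrable f μ) {M : ℝ} (h : ∀ y, f y ≤ M) :
    ∫ y, f y ∂μ ≤ M * μ.real Set.univ := by
  simpa [mul_comm] using integral_mono hf (integrable_const M) h

/-- at a maximizer of the Nash functional, with
`a₀ = (min s / max s)²`, the first-marginal masses satisfy
`a₀/(a₀+N−1) ≤ α({p_i}) ≤ 1/(1+(N−1)a₀)`, and any two masses have ratio at least `a₀`. -/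
theorem nash_maximizer_marginal_mass_bounds
    {Y : Type*} [MetricSpace Y] [CompactSpace Y] [MeasurableSpace Y] [BorelSpace Y]
    (ν : Measure Y) [IsProbabilityMeasure ν] {N : ℕ} (hN : 0 < N)
    (s : Fin N → Y → ℝ) (hs : ∀ i, Continuous (s i)) (hpos : ∀ i y, 0 < s i y)
    (π : Measure (Fin N × Y)) (hπ : IsProbabilityMeasure π) (hmarg : π.map Prod.snd = ν)
    (hmax : ∀ π' : Measure (Fin N × Y), IsProbabilityMeasure π' → π'.map Prod.snd = ν →
      NashF s π' ≤ NashF s π)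
    (α : Measure (Fin N)) (hα : α = π.map Prod.fst)
    (a₀ : ℝ)
    (ha₀ : a₀ = (sInf (Set.range fun p : Fin N × Y => s p.1 p.2) /
      sSup (Set.range fun p : Fin N × Y => s p.1 p.2)) ^ 2) :
    (∀ i : Fin N,
      a₀ / (a₀ + (N : ℝ) - 1) ≤ (α {i}).toReal ∧
      (α {i}).toReal ≤ 1 / (1 + ((N : ℝ) - 1) * a₀)) ∧
    (∀ i j : Fin N, a₀ ≤ (α {i}).toReal / (α {j}).toReal) := by
  have : Nonempty Y := ν.nonempty_of_neZero
  have : NeZero N := ⟨hN.ne'⟩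
  have hcont : Continuous fun p : Fin N × Y => s p.1 p.2 :=
    continuous_prod_of_discrete_left.2 hs
  have hcpt := isCompact_range hcont
  have hne : (Set.range fun p : Fin N × Y => s p.1 p.2).Nonempty := Set.range_nonempty _
  set m := sInf (Set.range fun p : Fin N × Y => s p.1 p.2)
  set M := sSup (Set.range fun p : Fin N × Y => s p.1 p.2)
  have hm : ∀ i y, m ≤ s i y := fun i y => csInf_le hcpt.bddBelow ⟨(i, y), rfl⟩
  have hM : ∀ i y, s i y ≤ M := fun i y => le_csSup hcpt.bddAbove ⟨(i, y), rfl⟩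
  have hm0 : 0 < m := by
    obtain ⟨p, hp⟩ := hcpt.sInf_mem hne
    exact (hpos p.1 p.2).trans_eq hp
  have hmM : m ≤ M := csInf_le_csSup hne hcpt.bddBelow hcpt.bddAbove
  have hM0 : 0 < M := hm0.trans_le hmM
  have hint : ∀ (i : Fin N) (μ : Measure Y) [IsFiniteMeasure μ], Integrable (s i) μ :=
    fun i μ _ => (hs i).integrable_of_hasCompactSupport (HasCompactSupport.of_compactSpace _)
  have hp : ∀ k, 0 < ∫ y, s k y ∂(nuI π k) := by
    refine (sum_log_le_of_maximizer hN hmax (μ := fun _ => (N : ℝ≥0)⁻¹ • ν) ?_ fun k => ?_).1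
    · rw [Finset.sum_const, Finset.card_univ, Fintype.card_fin, ← Nat.cast_smul_eq_nsmul ℝ≥0,
        smul_smul, mul_inv_cancel₀ (by exact_mod_cast hN.ne'), one_smul]
    · rw [integral_smul_nnreal_measure]
      have h := mul_real_univ_le_integral (hint k ν) (hm k)
      rw [probReal_univ, mul_one] at h
      have h' := hm0.trans_le h
      have hc : (0 : ℝ≥0) < (N : ℝ≥0)⁻¹ := by positivity
      exact smul_pos hc h'
  set a : Fin N → ℝ := fun i => (α {i}).toReal with ha
  have hreal : ∀ i, (nuI π i).real Set.univ = a i := by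
    intro i
    rw [Measure.real, nuI_apply π i .univ, ha, hα]
    simp only
    rw [Measure.map_apply measurable_fst (measurableSet_singleton i), Set.prod_univ]
  have hupper : ∀ i, ∫ y, s i y ∂(nuI π i) ≤ M * a i := fun i =>
    hreal i ▸ integral_le_mul_real_univ (hint i _) (hM i)
  have hapos : ∀ i, 0 < a i := fun i =>
    pos_of_mul_pos_right ((hp i).trans_le (hupper i)) hM0.le
  have hma : ∀ i j, m * a j ≤ M * a i := fun i j =>
    ((hreal j ▸ mul_real_univ_le_integral (hint i _) (hm i)).trans
      (integral_nuI_le_of_maximizer hN hmarg hmax (fun i j => hint i _)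
        (fun i y => (hpos i y).le) hp i j)).trans (hupper i)
  have ha₀0 : 0 < a₀ := by rw [ha₀]; positivity
  have ha₀le : a₀ ≤ m / M := by
    rw [ha₀]
    exact pow_le_of_le_one (by positivity) ((div_le_one hM0).2 hmM) two_ne_zero
  have hratio : ∀ i j, a₀ * a j ≤ a i := by
    intro i j
    refine (mul_le_mul_of_nonneg_right ha₀le (hapos j).le).trans ?_
    rw [div_mul_eq_mul_div, div_le_iff₀ hM0, mul_comm (a i)]
    exact hma i j
  have hsum : ∑ i, a i = 1 := by
    have : IsProbabilityMeasure α :=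
      hα ▸ Measure.isProbabilityMeasure_map measurable_fst.aemeasurable
    simpa [Measure.real] using sum_measureReal_singleton (μ := α) Finset.univ
  have hrest : ∀ i, ∑ k ∈ Finset.univ.erase i, a k = 1 - a i := by
    intro i
    rw [← hsum, ← Finset.add_sum_erase _ _ (Finset.mem_univ i), add_sub_cancel_left]
  have hcard : ∀ i : Fin N, ((Finset.univ.erase i).card : ℝ) = N - 1 := by
    intro i
    rw [Finset.card_erase_of_mem (Finset.mem_univ i), Finset.card_univ, Fintype.card_fin,
      Nat.cast_pred hN]
  have hN1 : (1 : ℝ) ≤ N := by exact_mod_cast hN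
  refine ⟨fun i => ⟨?_, ?_⟩, fun i j => (le_div_iff₀ (hapos j)).2 (hratio i j)⟩
  · have h := Finset.sum_le_card_nsmul (Finset.univ.erase i) (fun k => a₀ * a k) (a i)
      fun k _ => hratio i k
    rw [← Finset.mul_sum, hrest, nsmul_eq_mul, hcard] at h
    change _ ≤ a i
    rw [div_le_iff₀ (by linarith)]
    linarith
  · have h := Finset.card_nsmul_le_sum (Finset.univ.erase i) a (a₀ * a i)
      fun k _ => hratio k i
    rw [hrest, nsmul_eq_mul, hcard] at h
    change a i ≤ _
    rw [le_div_iff₀ (by nlinarith)]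
    linarith
end
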